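/- arXiv:math/0204083 — 4 statements merged into one kernel-verified Lean document; each statement's English description precedes it below -/
import Mathlib

section
/- Let M_A be the 47×47 intersection matrix of Configuration A, and for a subset T ⊆ {1,…,15} let M_A(T) be the principal submatrix of M_A obtained by deleting the rows and columns of the vertices e_j with j ∈ T (so M_A(T) is indexed by C1, C2, the 30 weight −2,−3,−4,−7 vertices, and the e_j with j ∉ T). Write 𝒯1 = T ∩ {1,2,3}, 𝒯2 = T ∩ {4,…,9}, 𝒯3 = T ∩ {10,…,15}, and t_i = |𝒯i|. Let σ be the permutation of {1,…,15} fixing 1,…,9 and swapping 10↔15, 11↔14, 12↔13 (a graph automorphism of Configuration A). Call T admissible if: (1) t1 + t2 ≥ 1, t3 ≥ 1, and not (t1 = 0 and 𝒯2 = {9}); and moreover: (2) if t2 = 0 and t3 = 1 then 10 ∈ 𝒯3; (3) if t2 ≥ 1 and t3 = 1 then: 10 ∈ 𝒯3 when max 𝒯2 ≤ 6; {10,11} ∩ 𝒯3 ≠ ∅ when max 𝒯2 = 7; and 𝒯3 arbitrary when max 𝒯2 ∈ {8,9}; (4) if t2 = 0 and t3 = 2 then either 10 ∈ 𝒯3,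 or (𝒯3 = {11,14} and 𝒯1 ≠ {3}); (5) if t2 ≥ 1 and t3 = 2 then either 10 ∈ 𝒯3, or 𝒯3 = {11,14}, or (𝒯3 = {11,13} and max 𝒯2 ≥ 5), or (𝒯3 = {11,12} and {7,8,9} ∩ 𝒯2 ≠ ∅), or (𝒯3 = {12,13} and {8,9} ∩ 𝒯2 ≠ ∅); (6) if t2 = 0 and t3 = 3 then either 10 ∈ 𝒯3, or (𝒯3 = {11,12,14} and 𝒯1 ≠ {3}); (7) if t2 ≥ 1 and t3 = 3 then either 10 ∈ 𝒯3, or 𝒯3 = {11,12,14}, or (𝒯3 = {11,12,13} and max 𝒯2 ≥ 5); (8) if t2 = 0 and t3 = 4 then either 10 ∈ 𝒯3, or (𝒯3 = {11,12,13,14} and 𝒯1 ≠ {3}); (9) if (t2 ≥ 1 and t3 ≥ 4) or t3 ≥ 5, no further condition. Then M_A(T) is negative definite if and only if T or σ(T) is admissible. -/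
open Matrix

/-- Edges of Configuration A.  Vertex numbering: `0 = C1`, `16 = C2`,
`j = e_j` for `1 ≤ j ≤ 15`, and `17,…,46` are the thirty weight
`-2,-3,-4,-7` vertices, listed chain by chain. -/
def edgesA : List (ℕ × ℕ) :=
  [(17,18),(18,19),(19,1),(1,0),
   (0,2),(2,20),(20,21),(21,22),(22,3),(3,23),(23,24),
   (0,4),(4,25),(25,26),(26,27),(27,5),(5,28),(28,29),(29,6),(6,30),(30,7),(7,31),
   (31,32),(32,8),(8,33),(33,34),(34,35),(35,9),(9,16),
   (16,10),(10,36),(36,37),(37,38),(38,11),(11,39),(39,40),(40,12),(12,41),(41,13),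
   (13,42),(42,43),(43,14),(14,44),(44,45),(45,46),(46,15),(15,16)]

/-- Edges of Configuration B: as in Configuration A, except that chain (ii)
is attached to `C2` and chain (iv) starts at `C1`. -/
def edgesB : List (ℕ × ℕ) :=
  [(17,18),(18,19),(19,1),(1,0),
   (16,2),(2,20),(20,21),(21,22),(22,3),(3,23),(23,24),
   (0,4),(4,25),(25,26),(26,27),(27,5),(5,28),(28,29),(29,6),(6,30),(30,7),(7,31),
   (31,32),(32,8),(8,33),(33,34),(34,35),(35,9),(9,16),
   (0,10),(10,36),(36,37),(37,38),(38,11),(11,39),(39,40),(40,12),(12,41),(41,13),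
   (13,42),(42,43),(43,14),(14,44),(44,45),(45,46),(46,15),(15,16)]

/-- The weights (self-intersections) of the 47 vertices, in the numbering above
(the same for Configurations A and B). -/
def weights : List ℚ :=
  [-14, -1,-1,-1,-1,-1,-1,-1,-1,-1,-1,-1,-1,-1,-1,-1, -14,
   -3,-2,-2,
   -2,-2,-3,-4,-2,
   -2,-2,-3,-4,-2,-7,-2,-4,-3,-2,-2,
   -2,-2,-3,-4,-2,-7,-2,-4,-3,-2,-2]

/-- Adjacency of a weighted graph given by an edge list. -/
def Adj (E : List (ℕ × ℕ)) (i j : Fin 47) : Prop :=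
  ((i : ℕ), (j : ℕ)) ∈ E ∨ ((j : ℕ), (i : ℕ)) ∈ E

instance (E : List (ℕ × ℕ)) (i j : Fin 47) : Decidable (Adj E i j) := by
  unfold Adj; infer_instance

/-- The intersection matrix of a weighted graph on 47 vertices:
diagonal entries the weights, off-diagonal entries `1` for adjacent
vertices and `0` otherwise. -/
def interMatrix (E : List (ℕ × ℕ)) : Matrix (Fin 47) (Fin 47) ℚ :=
  Matrix.of fun i j =>
    if i = j then weights.getD (i : ℕ) 0 else if Adj E i j then 1 else 0

/-- The 47×47 intersection matrix of Configuration A. -/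
def MA : Matrix (Fin 47) (Fin 47) ℚ := interMatrix edgesA

/-- The 47×47 intersection matrix of Configuration B. -/
def MB : Matrix (Fin 47) (Fin 47) ℚ := interMatrix edgesB

/-- A matrix over ℚ is negative definite (as a quadratic form). -/
def NegDef {n : Type*} [Fintype n] (M : Matrix n n ℚ) : Prop :=
  ∀ x : n → ℚ, x ≠ 0 → x ⬝ᵥ M.mulVec x < 0

/-- The principal submatrix of `M` obtained by deleting the rows and columns of
the vertices `e_j` with `j ∈ T` (in the numbering above, vertex `e_j` is `j`). -/
def delSub (M : Matrix (Fin 47) (Fin 47) ℚ) (T : Finset ℕ) :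
    Matrix {v : Fin 47 // (v : ℕ) ∉ T} {v : Fin 47 // (v : ℕ) ∉ T} ℚ :=
  M.submatrix (fun v => v.1) (fun v => v.1)

/-- The graph automorphism σ of Configuration A: it fixes `1,…,9` and swaps
`10↔15`, `11↔14`, `12↔13`. -/
def sigmaA : ℕ → ℕ := fun j => if 10 ≤ j ∧ j ≤ 15 then 25 - j else j

/-- The admissibility condition of the classification theorem in case (A₂⁶). -/
def AdmissibleA (T : Finset ℕ) : Prop :=
  let T1 := T ∩ Finset.Icc 1 3
  let T2 := T ∩ Finset.Icc 4 9
  let T3 := T ∩ Finset.Icc 10 15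
  -- (1)
  (1 ≤ T1.card + T2.card ∧ 1 ≤ T3.card ∧ ¬(T1.card = 0 ∧ T2 = {9})) ∧
  -- (2)
  (T2.card = 0 ∧ T3.card = 1 → 10 ∈ T3) ∧
  -- (3)
  (1 ≤ T2.card ∧ T3.card = 1 →
    (T2.max ≤ ((6 : ℕ) : WithBot ℕ) → 10 ∈ T3) ∧
    (T2.max = ((7 : ℕ) : WithBot ℕ) → ({10, 11} : Finset ℕ) ∩ T3 ≠ ∅)) ∧
  -- (4)
  (T2.card = 0 ∧ T3.card = 2 → 10 ∈ T3 ∨ (T3 = {11, 14} ∧ T1 ≠ {3})) ∧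
  -- (5)
  (1 ≤ T2.card ∧ T3.card = 2 →
    10 ∈ T3 ∨ T3 = {11, 14} ∨
    (T3 = {11, 13} ∧ ((5 : ℕ) : WithBot ℕ) ≤ T2.max) ∨
    (T3 = {11, 12} ∧ ({7, 8, 9} : Finset ℕ) ∩ T2 ≠ ∅) ∨
    (T3 = {12, 13} ∧ ({8, 9} : Finset ℕ) ∩ T2 ≠ ∅)) ∧
  -- (6)
  (T2.card = 0 ∧ T3.card = 3 → 10 ∈ T3 ∨ (T3 = {11, 12, 14} ∧ T1 ≠ {3})) ∧
  -- (7)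
  (1 ≤ T2.card ∧ T3.card = 3 →
    10 ∈ T3 ∨ T3 = {11, 12, 14} ∨
    (T3 = {11, 12, 13} ∧ ((5 : ℕ) : WithBot ℕ) ≤ T2.max)) ∧
  -- (8)
  (T2.card = 0 ∧ T3.card = 4 → 10 ∈ T3 ∨ (T3 = {11, 12, 13, 14} ∧ T1 ≠ {3}))

/-- A symmetric matrix with nonnegative off-diagonal entries is negative definite as soon as it
sends some positive vector to a negative one. -/
theorem NegDef.of_mulVec_neg {n : Type*} [Fintype n] {M : Matrix n n ℚ} (hsymm : M.IsSymm)
    (hoff : ∀ i j, i ≠ j → 0 ≤ M i j) {u : n → ℚ} (hu : ∀ i, 0 < u i)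
    (hMu : ∀ i, (M *ᵥ u) i < 0) : NegDef M := by
  intro x hx
  have hterm : ∀ i j, x i * (M i j * x j) ≤
      (x i ^ 2 / u i * (M i j * u j) + x j ^ 2 / u j * (M j i * u i)) / 2 := by
    intro i j
    have hi := hu i
    have hj := hu j
    rw [hsymm.apply i j]
    have hdiff : (x i ^ 2 / u i * (M i j * u j) + x j ^ 2 / u j * (M i j * u i)) / 2 -
        x i * (M i j * x j) = M i j * (u i * u j) / 2 * (x i / u i - x j / u j) ^ 2 := by
      field_simp
      ring
    rcases eq_or_ne i j with rfl | hij
    · simp only [sub_self] at hdiff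
      linarith
    · have := hoff i j hij
      have : 0 ≤ M i j * (u i * u j) / 2 * (x i / u i - x j / u j) ^ 2 := by positivity
      linarith
  have hle : x ⬝ᵥ M *ᵥ x ≤ ∑ i, x i ^ 2 / u i * (M *ᵥ u) i := by
    have hswap : ∑ i, ∑ j, x j ^ 2 / u j * (M j i * u i) =
        ∑ i, ∑ j, x i ^ 2 / u i * (M i j * u j) := Finset.sum_comm
    calc x ⬝ᵥ M *ᵥ x = ∑ i, ∑ j, x i * (M i j * x j) := by
          simp only [dotProduct, mulVec, Finset.mul_sum]
      _ ≤ ∑ i, ∑ j, (x i ^ 2 / u i * (M i j * u j) + x j ^ 2 / u j * (M j i * u i)) / 2 :=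
          Finset.sum_le_sum fun i _ => Finset.sum_le_sum fun j _ => hterm i j
      _ = ∑ i, ∑ j, x i ^ 2 / u i * (M i j * u j) := by
          simp only [← Finset.sum_div, Finset.sum_add_distrib]
          rw [hswap]
          ring
      _ = ∑ i, x i ^ 2 / u i * (M *ᵥ u) i := by
          simp only [dotProduct, mulVec, Finset.mul_sum]
  obtain ⟨k, hk⟩ := Function.ne_iff.mp hx
  refine hle.trans_lt (Finset.sum_neg' (fun i _ => ?_) ⟨k, Finset.mem_univ k, ?_⟩)
  · exact mul_nonpos_of_nonneg_of_nonpos (div_nonneg (sq_nonneg _) (hu i).le) (hMu i).le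
  · exact mul_neg_of_pos_of_neg (div_pos (sq_pos_of_ne_zero hk) (hu k)) (hMu k)

theorem NegDef.delSub_of_mulVec_neg {M : Matrix (Fin 47) (Fin 47) ℚ} (hsymm : M.IsSymm)
    (hoff : ∀ i j, i ≠ j → 0 ≤ M i j) {u : Fin 47 → ℚ} (hu : ∀ i, 0 ≤ u i)
    (hMu : ∀ i, u i ≠ 0 → (M *ᵥ u) i < 0) {T : Finset ℕ}
    (hT : ∀ i : Fin 47, u i = 0 → (i : ℕ) ∈ T) : NegDef (delSub M T) := by
  have hpos : ∀ i : {v : Fin 47 // (v : ℕ) ∉ T}, u i ≠ 0 := fun i h => i.2 (hT _ h)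
  refine NegDef.of_mulVec_neg (u := fun i => u i) (hsymm.submatrix _)
    (fun i j hij => hoff _ _ (Subtype.coe_injective.ne hij))
    (fun i => (hu i).lt_of_ne' (hpos i)) fun i => ?_
  refine lt_of_le_of_lt ?_ (hMu i (hpos i))
  simp only [mulVec, dotProduct, delSub, submatrix_apply]
  rw [← Fintype.sum_subtype_add_sum_subtype (fun v : Fin 47 => (v : ℕ) ∉ T)]
  refine le_add_of_nonneg_right (Finset.sum_nonneg fun j _ => mul_nonneg (hoff _ _ ?_) (hu j))
  rintro h
  exact j.2 (h ▸ i.2)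

theorem not_negDef_delSub_of_mulVec_nonneg {M : Matrix (Fin 47) (Fin 47) ℚ} {v : Fin 47 → ℚ}
    (hv : ∀ i, 0 ≤ v i) (hv0 : v ≠ 0) (hMv : ∀ i, v i ≠ 0 → 0 ≤ (M *ᵥ v) i) {T : Finset ℕ}
    (hT : ∀ i : Fin 47, (i : ℕ) ∈ T → v i = 0) : ¬ NegDef (delSub M T) := by
  intro h
  obtain ⟨k, hk⟩ := Function.ne_iff.mp hv0
  have hkT : (k : ℕ) ∉ T := fun hmem => hk (hT k hmem)
  refine (h (fun i => v i) (Function.ne_iff.mpr ⟨⟨k, hkT⟩, hk⟩)).not_ge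
    (Finset.sum_nonneg fun i _ => ?_)
  have hrow : (delSub M T *ᵥ fun i => v i) i = (M *ᵥ v) i := by
    simp only [mulVec, dotProduct, delSub, submatrix_apply]
    rw [← Fintype.sum_subtype_add_sum_subtype (fun v : Fin 47 => (v : ℕ) ∉ T), left_eq_add]
    exact Finset.sum_eq_zero fun j _ => by rw [hT j (not_not.mp j.2), mul_zero]
  rw [hrow]
  rcases eq_or_ne (v i) 0 with h0 | h0
  · simp [h0]
  · exact mul_nonneg (hv i) (hMv i h0)

/-- The absolute values of the weights. -/
def absWeights : List ℕ :=
  [14, 1, 1, 1, 1, 1, 1, 1, 1, 1, 1, 1, 1, 1, 1, 1, 14, 3, 2, 2, 2, 2, 3, 4, 2, 2, 2, 3, 4, 2, 7, 2,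
    4, 3, 2, 2, 2, 2, 3, 4, 2, 7, 2, 4, 3, 2, 2]

/-- The neighbours of each vertex of Configuration A. -/
def neighborsA : List (List ℕ) :=
  [[1, 2, 4], [0, 19], [0, 20], [22, 23], [0, 25], [27, 28], [29, 30], [30, 31], [32, 33], [16,
    35], [16, 36], [38, 39], [40, 41], [41, 42], [43, 44], [16, 46], [9, 10, 15], [18], [17, 19],
    [1, 18], [2, 21], [20, 22], [3, 21], [3, 24], [23], [4, 26], [25, 27], [5, 26], [5, 29], [6,
    28], [6, 7], [7, 32], [8, 31], [8, 34], [33, 35], [9, 34], [10, 37], [36, 38], [11, 37], [11,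
    40], [12, 39], [12, 13], [13, 43], [14, 42], [14, 45], [44, 46], [15, 45]]

theorem mem_neighborsA_iff (i j : Fin 47) :
    (j : ℕ) ∈ neighborsA.getD i [] ↔ Adj edgesA i j := by
  constructor
  · have h : ∀ i < 47, ∀ j ∈ neighborsA.getD i [], (i, j) ∈ edgesA ∨ (j, i) ∈ edgesA := by
      decide +kernel
    exact h i i.2 j
  · have h : ∀ e ∈ edgesA,
        e.2 ∈ neighborsA.getD e.1 [] ∧ e.1 ∈ neighborsA.getD e.2 [] := by
      decide +kernel
    rintro (hij | hij)
    · exact (h _ hij).1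
    · exact (h _ hij).2

theorem not_adj_self (i : Fin 47) : ¬ Adj edgesA i i := by
  have h : ∀ e ∈ edgesA, e.1 ≠ e.2 := by decide
  rintro (hi | hi) <;> exact h _ hi rfl

theorem weights_getD (i : ℕ) : weights.getD i 0 = -(absWeights.getD i 0 : ℚ) := by
  have h : weights = absWeights.map fun a : ℕ => -(a : ℚ) := by
    simp [weights, absWeights]
  rw [h, List.getD_eq_getElem?_getD, List.getD_eq_getElem?_getD, List.getElem?_map]
  cases absWeights[i]? <;> simp

theorem MA_apply_of_ne {i j : Fin 47} (h : i ≠ j) :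
    MA i j = if Adj edgesA i j then 1 else 0 := by
  simp [MA, interMatrix, h]

theorem MA_nonneg_of_ne (i j : Fin 47) (h : i ≠ j) : 0 ≤ MA i j := by
  rw [MA_apply_of_ne h]
  positivity

theorem MA_isSymm : MA.IsSymm := by
  refine IsSymm.ext fun i j => ?_
  rcases eq_or_ne i j with rfl | h
  · rfl
  · rw [MA_apply_of_ne h, MA_apply_of_ne h.symm]
    simp only [Adj, or_comm]

/-- The sum of the coefficients of a vector, given as a list, over the neighbours of a vertex. -/
def neighborSum (l : List ℕ) (i : ℕ) : ℕ :=
  ((neighborsA.getD i []).map fun j => l.getD j 0).sum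

theorem MA_mulVec_getD (l : List ℕ) (i : Fin 47) :
    (MA *ᵥ fun j : Fin 47 => (l.getD j 0 : ℚ)) i =
      neighborSum l i - absWeights.getD i 0 * l.getD i 0 := by
  have hentry : ∀ j : Fin 47, MA i j * (l.getD j 0 : ℚ) =
      (if (j : ℕ) ∈ neighborsA.getD i [] then (l.getD j 0 : ℚ) else 0) -
        if i = j then (absWeights.getD i 0 * l.getD i 0 : ℚ) else 0 := by
    intro j
    rw [if_congr (mem_neighborsA_iff i j) rfl rfl]
    rcases eq_or_ne i j with rfl | h
    · rw [MA, interMatrix, of_apply, if_pos rfl, weights_getD, if_neg (not_adj_self i)]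
      simp
    · simp [MA_apply_of_ne h, h]
  have hlt : ∀ i < 47, (neighborsA.getD i []).Nodup ∧ ∀ j ∈ neighborsA.getD i [], j < 47 := by
    decide +kernel
  have hfilter : (Finset.range 47).filter (· ∈ neighborsA.getD i []) =
      (neighborsA.getD i []).toFinset := by
    ext j
    simpa using (hlt i i.2).2 j
  simp only [mulVec, dotProduct, hentry, Finset.sum_sub_distrib, Finset.sum_ite_eq,
    Finset.mem_univ, if_true]
  rw [Fin.sum_univ_eq_sum_range
      (fun j => if j ∈ neighborsA.getD i [] then (l.getD j 0 : ℚ) else 0) 47,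
    ← Finset.sum_filter, hfilter, ← Nat.cast_sum, List.sum_toFinset _ (hlt i i.2).1, neighborSum]

/-- Vectors certifying, up to `sigmaA`, that `delSub MA T` is negative definite for the minimal
such `T`. -/
def negVectors : List (List ℕ) :=
  [[36, 0, 184, 100, 317, 366, 399, 419, 426, 417, 0, 103, 190, 263, 322, 365, 56, 1, 2, 2, 147,
    109, 70, 29, 15, 280, 242, 203, 162, 281, 117, 301, 182, 243, 302, 360, 16, 31, 45, 57, 124,
    65, 197, 130, 191, 250, 308],
   [24, 92, 0, 9, 239, 294, 333, 359, 372, 369, 0, 96, 176, 242, 294, 330, 50, 14, 41, 67, 3, 5,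
    5, 3, 2, 214, 188, 161, 132, 233, 99, 259, 158, 213, 266, 318, 15, 29, 42, 53, 115, 60, 181,
    119, 174, 227, 279],
   [188, 666, 666, 0, 1299, 1266, 1217, 1155, 1080, 989, 0, 186, 353, 507, 648, 773, 126, 96, 287,
    477, 477, 287, 96, 1, 1, 1110, 920, 729, 536, 877, 339, 815, 474, 605, 734, 862, 28, 55, 81,
    104, 229, 123, 383, 258, 389, 518, 646],
   [5, 26, 40, 29, 0, 75, 134, 180, 213, 230, 0, 75, 134, 180, 213, 230, 33, 5, 13, 20, 34, 27,
    19, 9, 5, 12, 23, 33, 41, 88, 45, 134, 87, 125, 161, 196, 12, 23, 33, 41, 88, 45, 134, 87,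
    125, 161, 196],
   [15, 61, 86, 51, 61, 0, 67, 120, 159, 182, 0, 68, 120, 159, 185, 195, 27, 10, 28, 45, 70, 53,
    35, 15, 8, 45, 28, 10, 10, 39, 27, 92, 63, 95, 125, 154, 11, 21, 30, 37, 79, 40, 118, 76, 108,
    138, 167],
   [36, 134, 184, 100, 184, 100, 0, 61, 108, 139, 0, 63, 109, 142, 162, 166, 22, 20, 59, 97, 147,
    109, 70, 29, 15, 147, 109, 70, 29, 15, 9, 51, 40, 67, 92, 116, 11, 20, 28, 34, 72, 36, 105,
    67, 94, 119, 143],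
   [84, 302, 408, 212, 465, 326, 171, 0, 54, 91, 0, 56, 95, 121, 134, 131, 16, 44, 131, 217, 323,
    237, 150, 61, 31, 380, 294, 207, 118, 145, 25, 9, 16, 37, 56, 74, 10, 18, 25, 30, 63, 31, 89,
    56, 77, 96, 114],
   [238, 841, 1127, 572, 1363, 1044, 709, 361, 0, 43, 0, 49, 81, 100, 106, 96, 10, 121, 362, 602,
    888, 648, 407, 164, 83, 1124, 884, 643, 400, 555, 153, 207, 52, 7, 20, 32, 9, 16, 22, 26, 54,
    26, 73, 45, 60, 73, 85],
   [84, 302, 408, 212, 465, 326, 171, 0, 572, 1127, 841, 0, 361, 709, 1044, 1363, 238, 44, 131,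
    217, 323, 237, 150, 61, 31, 380, 294, 207, 118, 145, 25, 83, 164, 407, 648, 888, 602, 362,
    121, 52, 207, 153, 555, 400, 643, 884, 1124],
   [238, 841, 1127, 572, 1363, 1044, 709, 361, 0, 127, 127, 0, 77, 139, 188, 221, 34, 121, 362,
    602, 888, 648, 407, 164, 83, 1124, 884, 643, 400, 555, 153, 207, 52, 19, 56, 92, 92, 56, 19,
    12, 45, 31, 107, 74, 113, 150, 186],
   [16, 0, 91, 54, 131, 134, 121, 95, 56, 0, 36, 0, 39, 65, 78, 75, 8, 1, 2, 2, 74, 56, 37, 16, 9,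
    114, 96, 77, 56, 89, 31, 63, 30, 25, 18, 10, 27, 17, 6, 6, 23, 15, 49, 32, 45, 56, 66],
   [10, 43, 0, 9, 96, 106, 100, 81, 49, 0, 36, 0, 39, 65, 78, 75, 8, 7, 20, 32, 3, 5, 5, 3, 2, 85,
    73, 60, 45, 73, 26, 54, 26, 22, 16, 9, 27, 17, 6, 6, 23, 15, 49, 32, 45, 56, 66],
   [48, 176, 176, 0, 318, 284, 234, 171, 95, 0, 36, 0, 39, 65, 78, 75, 8, 26, 77, 127, 127, 77,
    26, 1, 1, 269, 219, 168, 115, 175, 58, 112, 52, 42, 29, 15, 27, 17, 6, 6, 23, 15, 49, 32, 45,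
    56, 66],
   [5, 26, 40, 29, 0, 32, 45, 45, 32, 0, 36, 0, 39, 65, 78, 75, 8, 5, 13, 20, 34, 27, 19, 9, 5, 6,
    11, 15, 16, 31, 13, 31, 16, 15, 11, 6, 27, 17, 6, 6, 23, 15, 49, 32, 45, 56, 66],
   [15, 61, 86, 51, 61, 0, 23, 31, 25, 0, 36, 0, 39, 65, 78, 75, 8, 10, 28, 45, 70, 53, 35, 15, 8,
    45, 28, 10, 4, 14, 8, 22, 12, 12, 9, 5, 27, 17, 6, 6, 23, 15, 49, 32, 45, 56, 66],
   [36, 134, 184, 100, 184, 100, 0, 17, 18, 0, 36, 0, 39, 65, 78, 75, 8, 20, 59, 97, 147, 109, 70,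
    29, 15, 147, 109, 70, 29, 15, 3, 13, 8, 9, 7, 4, 27, 17, 6, 6, 23, 15, 49, 32, 45, 56, 66],
   [238, 841, 1127, 572, 1363, 1044, 709, 361, 0, 302, 408, 212, 0, 171, 326, 465, 84, 121, 362,
    602, 888, 648, 407, 164, 83, 1124, 884, 643, 400, 555, 153, 207, 52, 44, 131, 217, 323, 237,
    150, 61, 31, 25, 145, 118, 207, 294, 380],
   [16, 0, 91, 54, 131, 134, 121, 95, 56, 0, 63, 40, 0, 40, 66, 76, 10, 1, 2, 2, 74, 56, 37, 16,
    9, 114, 96, 77, 56, 89, 31, 63, 30, 25, 18, 10, 52, 40, 27, 12, 7, 6, 33, 25, 40, 53, 65],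
   [10, 43, 0, 9, 96, 106, 100, 81, 49, 0, 63, 40, 0, 40, 66, 76, 10, 7, 20, 32, 3, 5, 5, 3, 2,
    85, 73, 60, 45, 73, 26, 54, 26, 22, 16, 9, 52, 40, 27, 12, 7, 6, 33, 25, 40, 53, 65],
   [48, 176, 176, 0, 318, 284, 234, 171, 95, 0, 63, 40, 0, 40, 66, 76, 10, 26, 77, 127, 127, 77,
    26, 1, 1, 269, 219, 168, 115, 175, 58, 112, 52, 42, 29, 15, 52, 40, 27, 12, 7, 6, 33, 25, 40,
    53, 65],
   [5, 26, 40, 29, 0, 32, 45, 45, 32, 0, 63, 40, 0, 40, 66, 76, 10, 5, 13, 20, 34, 27, 19, 9, 5,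
    6, 11, 15, 16, 31, 13, 31, 16, 15, 11, 6, 52, 40, 27, 12, 7, 6, 33, 25, 40, 53, 65],
   [15, 61, 86, 51, 61, 0, 23, 31, 25, 0, 63, 40, 0, 40, 66, 76, 10, 10, 28, 45, 70, 53, 35, 15,
    8, 45, 28, 10, 4, 14, 8, 22, 12, 12, 9, 5, 52, 40, 27, 12, 7, 6, 33, 25, 40, 53, 65],
   [36, 134, 184, 100, 184, 100, 0, 17, 18, 0, 63, 40, 0, 40, 66, 76, 10, 20, 59, 97, 147, 109,
    70, 29, 15, 147, 109, 70, 29, 15, 3, 13, 8, 9, 7, 4, 52, 40, 27, 12, 7, 6, 33, 25, 40, 53, 65],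
   [84, 302, 408, 212, 465, 326, 171, 0, 9, 0, 63, 40, 0, 40, 66, 76, 10, 44, 131, 217, 323, 237,
    150, 61, 31, 380, 294, 207, 118, 145, 25, 2, 3, 5, 5, 3, 52, 40, 27, 12, 7, 6, 33, 25, 40, 53,
    65],
   [15, 61, 86, 51, 61, 0, 361, 709, 1044, 1363, 841, 0, 9, 0, 572, 1127, 238, 10, 28, 45, 70, 53,
    35, 15, 8, 45, 28, 10, 52, 207, 153, 555, 400, 643, 884, 1124, 602, 362, 121, 2, 6, 2, 83,
    164, 407, 648, 888],
   [36, 134, 184, 100, 184, 100, 0, 171, 326, 465, 302, 0, 9, 0, 212, 408, 84, 20, 59, 97, 147,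
    109, 70, 29, 15, 147, 109, 70, 29, 15, 25, 145, 118, 207, 294, 380, 217, 131, 44, 2, 6, 2, 31,
    61, 150, 237, 323],
   [54, 0, 268, 142, 485, 576, 651, 713, 762, 795, 414, 0, 16, 16, 0, 414, 116, 1, 2, 2, 213, 157,
    100, 41, 21, 430, 374, 317, 258, 455, 195, 517, 320, 441, 560, 678, 297, 179, 60, 3, 10, 5,
    10, 3, 60, 179, 297],
   [34, 127, 0, 9, 345, 436, 511, 573, 622, 655, 344, 0, 16, 16, 0, 344, 96, 19, 56, 92, 3, 5, 5,
    3, 2, 310, 274, 237, 198, 355, 155, 417, 260, 361, 460, 558, 247, 149, 50, 3, 10, 5, 10, 3,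
    50, 149, 247],
   [5, 26, 40, 29, 0, 95, 171, 234, 284, 318, 176, 0, 16, 16, 0, 176, 48, 5, 13, 20, 34, 27, 19,
    9, 5, 15, 29, 42, 52, 112, 58, 175, 115, 168, 219, 269, 127, 77, 26, 3, 10, 5, 10, 3, 26, 77,
    127],
   [15, 61, 86, 51, 61, 0, 77, 139, 188, 221, 127, 0, 16, 16, 0, 127, 34, 10, 28, 45, 70, 53, 35,
    15, 8, 45, 28, 10, 12, 45, 31, 107, 74, 113, 150, 186, 92, 56, 19, 3, 10, 5, 10, 3, 19, 56,
    92],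
   [36, 134, 184, 100, 184, 100, 0, 66, 116, 150, 92, 0, 16, 16, 0, 92, 24, 20, 59, 97, 147, 109,
    70, 29, 15, 147, 109, 70, 29, 15, 10, 55, 43, 72, 99, 125, 67, 41, 14, 3, 10, 5, 10, 3, 14,
    41, 67]]

/-- Vectors certifying that `delSub MA T` is not negative definite for the maximal such `T`. -/
def nullVectors : List (List ℕ) :=
  [[0, 0, 0, 0, 0, 0, 0, 0, 0, 0, 7, 7, 7, 7, 7, 7, 1, 0, 0, 0, 0, 0, 0, 0, 0, 0, 0, 0, 0, 0, 0,
    0, 0, 0, 0, 0, 6, 5, 4, 3, 5, 2, 5, 3, 4, 5, 6],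
   [0, 0, 0, 0, 0, 0, 0, 7, 14, 21, 14, 0, 0, 7, 14, 21, 4, 0, 0, 0, 0, 0, 0, 0, 0, 0, 0, 0, 0, 0,
    1, 6, 5, 9, 13, 17, 10, 6, 2, 0, 0, 1, 6, 5, 9, 13, 17],
   [0, 0, 0, 0, 0, 0, 0, 0, 7, 14, 14, 7, 0, 0, 7, 14, 3, 0, 0, 0, 0, 0, 0, 0, 0, 0, 0, 0, 0, 0,
    0, 1, 2, 5, 8, 11, 11, 8, 5, 2, 1, 0, 1, 2, 5, 8, 11],
   [0, 0, 0, 0, 0, 7, 14, 21, 28, 35, 21, 0, 0, 0, 14, 28, 6, 0, 0, 0, 0, 0, 0, 0, 0, 1, 2, 3, 4,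
    9, 5, 16, 11, 17, 23, 29, 15, 9, 3, 0, 0, 0, 2, 4, 10, 16, 22],
   [0, 0, 0, 0, 0, 0, 0, 7, 14, 21, 21, 14, 7, 0, 0, 14, 4, 0, 0, 0, 0, 0, 0, 0, 0, 0, 0, 0, 0, 0,
    1, 6, 5, 9, 13, 17, 17, 13, 9, 5, 6, 1, 0, 0, 2, 6, 10],
   [0, 0, 0, 0, 0, 7, 14, 21, 28, 35, 28, 14, 0, 0, 0, 21, 6, 0, 0, 0, 0, 0, 0, 0, 0, 1, 2, 3, 4,
    9, 5, 16, 11, 17, 23, 29, 22, 16, 10, 4, 2, 0, 0, 0, 3, 9, 15],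
   [2, 7, 7, 0, 14, 14, 14, 14, 14, 14, 7, 0, 0, 0, 0, 7, 2, 1, 3, 5, 5, 3, 1, 0, 0, 12, 10, 8, 6,
    10, 4, 10, 6, 8, 10, 12, 5, 3, 1, 0, 0, 0, 0, 0, 1, 3, 5],
   [6, 21, 28, 14, 35, 28, 21, 14, 7, 0, 0, 0, 0, 0, 0, 0, 0, 3, 9, 15, 22, 16, 10, 4, 2, 29, 23,
    17, 11, 16, 5, 9, 4, 3, 2, 1, 0, 0, 0, 0, 0, 0, 0, 0, 0, 0, 0]]

/-- The minimal sets `T`, up to `sigmaA`, for which `delSub MA T` is negative definite. -/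
def minimalNegSets : List (List ℕ) :=
  [[1, 10], [2, 10], [3, 10], [4, 10], [5, 10], [6, 10], [7, 10], [8, 10],
   [7, 11], [8, 11], [1, 9, 11], [2, 9, 11], [3, 9, 11], [4, 9, 11], [5, 9, 11], [6, 9, 11],
   [8, 12], [1, 9, 12], [2, 9, 12], [3, 9, 12], [4, 9, 12], [5, 9, 12], [6, 9, 12], [7, 9, 12],
   [5, 11, 13], [6, 11, 13], [1, 11, 14], [2, 11, 14], [4, 11, 14], [5, 11, 14], [6, 11, 14]]

/-- The maximal sets `T` for which `delSub MA T` is not negative definite. -/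
def maximalNullSets : List (Finset ℕ) :=
  [{1, 2, 3, 4, 5, 6, 7, 8, 9}, {1, 2, 3, 4, 5, 6, 11, 12}, {1, 2, 3, 4, 5, 6, 13, 14},
   {1, 2, 3, 4, 5, 6, 7, 12, 13}, {1, 2, 3, 4, 11, 12, 13}, {1, 2, 3, 4, 12, 13, 14},
   {3, 11, 12, 13, 14}, {9, 10, 11, 12, 13, 14, 15}]

theorem neighborSum_lt_of_mem_negVectors :
    ∀ l ∈ negVectors, ∀ i < 47, l.getD i 0 ≠ 0 →
      neighborSum l i < absWeights.getD i 0 * l.getD i 0 := by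
  decide +kernel

theorem le_neighborSum_of_mem_nullVectors :
    ∀ l ∈ nullVectors, (∃ i < 47, l.getD i 0 ≠ 0) ∧
      ∀ i < 47, l.getD i 0 ≠ 0 → absWeights.getD i 0 * l.getD i 0 ≤ neighborSum l i := by
  decide +kernel

theorem exists_mem_negVectors :
    ∀ S ∈ minimalNegSets, ∃ l ∈ negVectors, ∀ i < 47, l.getD i 0 = 0 → i ∈ S := by
  decide +kernel

theorem exists_mem_nullVectors :
    ∀ S ∈ maximalNullSets, ∃ l ∈ nullVectors, ∀ i ∈ S, l.getD i 0 = 0 := by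
  decide +kernel

theorem negDef_of_mem_minimalNegSets {S : List ℕ} (hS : S ∈ minimalNegSets) {T : Finset ℕ}
    (hST : ∀ i ∈ S, i ∈ T) : NegDef (delSub MA T) := by
  obtain ⟨l, hl, hlS⟩ := exists_mem_negVectors S hS
  refine NegDef.delSub_of_mulVec_neg (u := fun i => (l.getD i 0 : ℚ)) MA_isSymm MA_nonneg_of_ne
    (fun i => Nat.cast_nonneg _) (fun i hi => ?_)
    (fun i hi => hST _ (hlS i i.2 (Nat.cast_eq_zero.mp hi)))
  rw [MA_mulVec_getD, sub_neg]
  exact_mod_cast neighborSum_lt_of_mem_negVectors l hl i i.2 (Nat.cast_ne_zero.mp hi)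

theorem not_negDef_of_subset_of_mem_maximalNullSets {S T : Finset ℕ} (hS : S ∈ maximalNullSets)
    (hTS : T ⊆ S) : ¬ NegDef (delSub MA T) := by
  obtain ⟨l, hl, hlS⟩ := exists_mem_nullVectors S hS
  obtain ⟨⟨k, hk47, hk⟩, hle⟩ := le_neighborSum_of_mem_nullVectors l hl
  refine not_negDef_delSub_of_mulVec_nonneg (v := fun i => (l.getD i 0 : ℚ))
    (fun i => Nat.cast_nonneg _) (Function.ne_iff.mpr ⟨⟨k, hk47⟩, Nat.cast_ne_zero.mpr hk⟩)
    (fun i hi => ?_) (fun i hi => Nat.cast_eq_zero.mpr (hlS i (hTS hi)))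
  rw [MA_mulVec_getD, sub_nonneg]
  exact_mod_cast hle i i.2 (Nat.cast_ne_zero.mp hi)

theorem NegDef.submatrix_equiv {m n : Type*} [Fintype m] [Fintype n] {M : Matrix n n ℚ}
    (h : NegDef M) (e : m ≃ n) : NegDef (M.submatrix e e) := by
  intro x hx
  have hx' : x ∘ e.symm ≠ 0 := by
    rintro h0
    refine hx (funext fun i => ?_)
    simpa using congrFun h0 (e i)
  rw [submatrix_mulVec_equiv, ← comp_equiv_symm_dotProduct]
  exact h _ hx'

/-- The automorphism of Configuration A reversing chain (iv). -/
def flipA (n : ℕ) : ℕ := if 36 ≤ n ∧ n ≤ 46 then 82 - n else sigmaA n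

theorem sigmaA_involutive : Function.Involutive sigmaA := by
  intro n
  unfold sigmaA
  grind

theorem flipA_involutive : Function.Involutive flipA := by
  intro n
  unfold flipA sigmaA
  grind

theorem flipA_lt {n : ℕ} (hn : n < 47) : flipA n < 47 := by
  unfold flipA sigmaA
  grind

/-- The permutation of the vertices given by `flipA`. -/
def flipPerm : Equiv.Perm (Fin 47) :=
  Function.Involutive.toPerm (fun i => ⟨flipA i, flipA_lt i.2⟩) fun i =>
    Fin.ext (flipA_involutive i)

theorem val_flipPerm (i : Fin 47) : (flipPerm i : ℕ) = flipA i := rfl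

theorem adj_flipPerm_of_adj {i j : Fin 47} (h : Adj edgesA i j) :
    Adj edgesA (flipPerm i) (flipPerm j) := by
  have hedge : ∀ e ∈ edgesA,
      (flipA e.1, flipA e.2) ∈ edgesA ∨ (flipA e.2, flipA e.1) ∈ edgesA := by
    decide +kernel
  rcases h with h | h
  · exact hedge _ h
  · exact (hedge _ h).symm

theorem adj_flipPerm_iff {i j : Fin 47} :
    Adj edgesA (flipPerm i) (flipPerm j) ↔ Adj edgesA i j := by
  refine ⟨fun h => ?_, adj_flipPerm_of_adj⟩
  have hinv : ∀ i, flipPerm (flipPerm i) = i := fun i => Fin.ext (flipA_involutive i)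
  simpa only [hinv] using adj_flipPerm_of_adj h

theorem MA_flipPerm (i j : Fin 47) : MA (flipPerm i) (flipPerm j) = MA i j := by
  rcases eq_or_ne i j with rfl | h
  · have hw : ∀ n < 47, absWeights.getD (flipA n) 0 = absWeights.getD n 0 := by decide +kernel
    simp only [MA, interMatrix, of_apply, if_true, weights_getD, val_flipPerm, hw i i.2]
  · rw [MA_apply_of_ne h, MA_apply_of_ne (flipPerm.injective.ne h),
      if_congr adj_flipPerm_iff rfl rfl]

theorem mem_image_sigmaA {T : Finset ℕ} {n : ℕ} : n ∈ T.image sigmaA ↔ sigmaA n ∈ T := by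
  rw [Finset.mem_image]
  exact ⟨fun ⟨a, ha, h⟩ => by rwa [← h, sigmaA_involutive], fun h => ⟨_, h, sigmaA_involutive n⟩⟩

theorem NegDef.of_image_sigmaA {T : Finset ℕ} (hT : T ⊆ Finset.Icc 1 15)
    (h : NegDef (delSub MA (T.image sigmaA))) : NegDef (delSub MA T) := by
  have hmem : ∀ v : Fin 47, (v : ℕ) ∉ T ↔ (flipPerm v : ℕ) ∉ T.image sigmaA := by
    intro v
    have hrange : ∀ n ∈ T, n ≤ 15 := fun n hn => (Finset.mem_Icc.mp (hT hn)).2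
    rw [mem_image_sigmaA, val_flipPerm, flipA]
    split_ifs with hv
    · have h1 : (v : ℕ) ∉ T := fun hv' => by have := hrange _ hv'; omega
      have h2 : sigmaA (82 - v) ∉ T := fun hv' => by
        have := hrange _ hv'
        unfold sigmaA at this
        grind
      simp only [h1, h2]
    · rw [sigmaA_involutive]
  have hsub : delSub MA T = (delSub MA (T.image sigmaA)).submatrix
      (flipPerm.subtypeEquiv hmem) (flipPerm.subtypeEquiv hmem) := by
    ext i j
    exact (MA_flipPerm i j).symm
  rw [hsub]
  exact h.submatrix_equiv _

/-- A propositional form of admissibility: `e0`, `e3`, `b0`, `b9` say that `T ∩ {1, 2, 3}` is `∅`,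
is `{3}`, that `T ∩ {4, …, 9}` is `∅`, is `{9}`, while `p4`, `p6`, `p7` say that all elements of
the latter are at most `4`, `6`, `7`. -/
def AdmissibleForm (e0 e3 b0 b9 p4 p6 p7 : Bool) (C : Finset ℕ) : Prop :=
  (¬(e0 = true ∧ b0 = true) ∧ 1 ≤ C.card ∧ ¬(e0 = true ∧ b9 = true)) ∧
  (b0 = true ∧ C.card = 1 → 10 ∈ C) ∧
  (b0 = false ∧ C.card = 1 →
    (p6 = true → 10 ∈ C) ∧ (p6 = false ∧ p7 = true → ({10, 11} : Finset ℕ) ∩ C ≠ ∅)) ∧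
  (b0 = true ∧ C.card = 2 → 10 ∈ C ∨ (C = {11, 14} ∧ e3 = false)) ∧
  (b0 = false ∧ C.card = 2 →
    10 ∈ C ∨ C = {11, 14} ∨ (C = {11, 13} ∧ p4 = false) ∨
    (C = {11, 12} ∧ p6 = false) ∨ (C = {12, 13} ∧ p7 = false)) ∧
  (b0 = true ∧ C.card = 3 → 10 ∈ C ∨ (C = {11, 12, 14} ∧ e3 = false)) ∧
  (b0 = false ∧ C.card = 3 →
    10 ∈ C ∨ C = {11, 12, 14} ∨ (C = {11, 12, 13} ∧ p4 = false)) ∧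
  (b0 = true ∧ C.card = 4 → 10 ∈ C ∨ (C = {11, 12, 13, 14} ∧ e3 = false))

set_option synthInstance.maxSize 4000 in
instance (e0 e3 b0 b9 p4 p6 p7 : Bool) : DecidablePred (AdmissibleForm e0 e3 b0 b9 p4 p6 p7) :=
  fun C => by unfold AdmissibleForm; infer_instance

set_option synthInstance.maxSize 4000 in
theorem admissibleForm_or_image_iff : ∀ e0 e3 b0 b9 p4 p6 p7 : Bool,
    ¬(e0 = true ∧ e3 = true) → (b0 → p4) → (p4 → p6) → (p6 → p7) → (b9 → ¬p7) →
    ∀ C ∈ (Finset.Icc 10 15).powerset,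
      (AdmissibleForm e0 e3 b0 b9 p4 p6 p7 C ∨
        AdmissibleForm e0 e3 b0 b9 p4 p6 p7 (C.image sigmaA) ↔
      ¬(C = ∅ ∨ (C ⊆ {11, 12} ∧ p6) ∨ (C ⊆ {13, 14} ∧ p6) ∨ (C ⊆ {12, 13} ∧ p7) ∨
        (C ⊆ {11, 12, 13} ∧ p4) ∨ (C ⊆ {12, 13, 14} ∧ p4) ∨
        (C ⊆ {11, 12, 13, 14} ∧ b0 ∧ (e0 ∨ e3)) ∨ (e0 ∧ (b0 ∨ b9)))) := by
  decide +kernel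

theorem admissibleA_iff_form (T : Finset ℕ) :
    AdmissibleA T ↔ AdmissibleForm
      (decide (T ∩ Finset.Icc 1 3 = ∅)) (decide (T ∩ Finset.Icc 1 3 = {3}))
      (decide (T ∩ Finset.Icc 4 9 = ∅)) (decide (T ∩ Finset.Icc 4 9 = {9}))
      (decide (∀ i ∈ T ∩ Finset.Icc 4 9, i ≤ 4)) (decide (∀ i ∈ T ∩ Finset.Icc 4 9, i ≤ 6))
      (decide (∀ i ∈ T ∩ Finset.Icc 4 9, i ≤ 7)) (T ∩ Finset.Icc 10 15) := by
  unfold AdmissibleA AdmissibleForm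
  have hB : ∀ i ∈ T ∩ Finset.Icc 4 9, i ≤ 9 := fun i hi => by
    simp only [Finset.mem_inter, Finset.mem_Icc] at hi
    omega
  generalize T ∩ Finset.Icc 1 3 = A, T ∩ Finset.Icc 4 9 = B, T ∩ Finset.Icc 10 15 = C at hB ⊢
  have hle : ∀ n : ℕ, B.max ≤ (n : WithBot ℕ) ↔ ∀ i ∈ B, i ≤ n := fun n => by
    exact Finset.max_le_iff.trans (forall₂_congr fun _ _ => WithBot.coe_le_coe)
  have hge : ∀ n : ℕ, ((n + 1 : ℕ) : WithBot ℕ) ≤ B.max ↔ ¬B.max ≤ (n : WithBot ℕ) := fun n => by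
    cases B.max using WithBot.recBotCoe with
    | bot => simp
    | coe m =>
      exact WithBot.coe_le_coe.trans
        (Nat.succ_le_iff.trans (not_le.symm.trans (not_congr WithBot.coe_le_coe.symm)))
  have h7 : B.max = ((7 : ℕ) : WithBot ℕ) ↔ ¬(∀ i ∈ B, i ≤ 6) ∧ ∀ i ∈ B, i ≤ 7 := by
    rw [← hle, ← hle, ← hge, le_antisymm_iff, and_comm]
  have h5 : ((5 : ℕ) : WithBot ℕ) ≤ B.max ↔ ¬∀ i ∈ B, i ≤ 4 := by
    rw [← hle, ← hge]
  have h789 : ({7, 8, 9} : Finset ℕ) ∩ B ≠ ∅ ↔ ¬∀ i ∈ B, i ≤ 6 := by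
    rw [← Finset.nonempty_iff_ne_empty]
    simp only [Finset.Nonempty, Finset.mem_inter, Finset.mem_insert, Finset.mem_singleton]
    push Not
    exact exists_congr fun i => by grind
  have h89 : ({8, 9} : Finset ℕ) ∩ B ≠ ∅ ↔ ¬∀ i ∈ B, i ≤ 7 := by
    rw [← Finset.nonempty_iff_ne_empty]
    simp only [Finset.Nonempty, Finset.mem_inter, Finset.mem_insert, Finset.mem_singleton]
    push Not
    exact exists_congr fun i => by grind
  have hsum : 1 ≤ A.card + B.card ↔ ¬(A = ∅ ∧ B = ∅) := by
    rw [← Finset.card_eq_zero, ← Finset.card_eq_zero]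
    omega
  have hB1 : 1 ≤ B.card ↔ ¬B = ∅ := by
    rw [← Finset.card_eq_zero]
    omega
  simp only [hle, h7, h5, h789, h89, hsum, hB1, Finset.card_eq_zero, decide_eq_true_eq,
    decide_eq_false_iff_not, ne_eq]

theorem image_sigmaA_inter_Icc_of_lt (T : Finset ℕ) (a : ℕ) {b : ℕ} (hb : b < 10) :
    T.image sigmaA ∩ Finset.Icc a b = T ∩ Finset.Icc a b := by
  ext n
  simp only [Finset.mem_inter, mem_image_sigmaA, Finset.mem_Icc]
  refine and_congr_left fun hn => ?_
  rw [sigmaA, if_neg (by omega)]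

theorem image_sigmaA_inter_Icc_last (T : Finset ℕ) :
    T.image sigmaA ∩ Finset.Icc 10 15 = (T ∩ Finset.Icc 10 15).image sigmaA := by
  ext n
  simp only [Finset.mem_inter, mem_image_sigmaA, Finset.mem_Icc]
  refine and_congr_right fun _ => ?_
  unfold sigmaA
  grind

theorem admissibleA_or_image_iff {T : Finset ℕ} (hT : T ⊆ Finset.Icc 1 15) :
    AdmissibleA T ∨ AdmissibleA (T.image sigmaA) ↔ ∀ S ∈ maximalNullSets, ¬T ⊆ S := by
  rw [admissibleA_iff_form T, admissibleA_iff_form (T.image sigmaA),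
    image_sigmaA_inter_Icc_of_lt T 1 (by norm_num), image_sigmaA_inter_Icc_of_lt T 4 (by norm_num),
    image_sigmaA_inter_Icc_last, admissibleForm_or_image_iff]
  · simp only [maximalNullSets, List.forall_mem_cons, List.not_mem_nil, IsEmpty.forall_iff,
      implies_true, and_true, not_or, decide_eq_true_eq, Finset.ext_iff, Finset.subset_iff,
      Finset.mem_inter, Finset.mem_Icc, Finset.mem_insert, Finset.mem_singleton,
      Finset.notMem_empty]
    have hT' : ∀ n ∈ T, 1 ≤ n ∧ n ≤ 15 := fun n hn => Finset.mem_Icc.mp (hT hn)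
    refine and_congr (not_congr ?_) <| and_congr (not_congr ?_) <| and_congr (not_congr ?_) <|
      and_congr (not_congr ?_) <| and_congr (not_congr ?_) <| and_congr (not_congr ?_) <|
      and_congr (not_congr ?_) (not_congr ?_)
    all_goals grind (splits := 20)
  · simp only [decide_eq_true_eq]
    rintro ⟨h0, h3⟩
    simp [h0] at h3
  · simp only [decide_eq_true_eq]
    rintro h0
    simp [h0]
  · simp only [decide_eq_true_eq]
    exact fun h i hi => (h i hi).trans (by norm_num)
  · simp only [decide_eq_true_eq]
    exact fun h i hi => (h i hi).trans (by norm_num)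
  · simp only [decide_eq_true_eq]
    rintro h9
    simp [h9]
  · simp

theorem exists_minimalNegSet {T : Finset ℕ} (hT : T ⊆ Finset.Icc 1 15)
    (h : ∀ S ∈ maximalNullSets, ¬T ⊆ S) :
    ∃ S ∈ minimalNegSets, (∀ i ∈ S, i ∈ T) ∨ ∀ i ∈ S, i ∈ T.image sigmaA := by
  have hIcc : Finset.Icc 1 15 = {1, 2, 3, 4, 5, 6, 7, 8, 9, 10, 11, 12, 13, 14, 15} := by decide
  have hexists : ∀ S : Finset ℕ, ¬T ⊆ S ↔ ∃ n ∈ Finset.Icc 1 15, n ∉ S ∧ n ∈ T := fun S => by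
    rw [Finset.not_subset]
    exact ⟨fun ⟨n, hn, hS⟩ => ⟨n, hT hn, hS, hn⟩, fun ⟨n, _, hS, hn⟩ => ⟨n, hn, hS⟩⟩
  simp only [hexists, hIcc, maximalNullSets, List.forall_mem_cons, Finset.mem_insert,
    Finset.mem_singleton] at h
  norm_num at h
  simp only [minimalNegSets, List.exists_mem_cons_iff, List.forall_mem_cons, mem_image_sigmaA]
  norm_num [sigmaA]
  clear hexists hIcc hT
  by_cases h10 : 10 ∈ T <;> by_cases h15 : 15 ∈ T <;> by_cases h11 : 11 ∈ T <;>
    by_cases h14 : 14 ∈ T <;>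
    simp only [*, true_and, and_true, false_and, and_false, true_or, or_true, false_or,
      or_false] at h ⊢ <;>
    grind (splits := 30)

/-- **Classification of log Enriques surfaces with δ = 2, case (A₂⁶).**
For `T ⊆ {1,…,15}`, the principal submatrix `M_A(T)` of the intersection
matrix of Configuration A obtained by deleting the exceptional curves `e_j`,
`j ∈ T`, is negative definite if and only if `T` or `σ(T)` is admissible. -/
theorem logEnriques_delta_two_classification_A26 (T : Finset ℕ)
    (hT : T ⊆ Finset.Icc 1 15) :
    NegDef (delSub MA T) ↔ AdmissibleA T ∨ AdmissibleA (T.image sigmaA) := by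
  rw [admissibleA_or_image_iff hT]
  constructor
  · intro h S hS hTS
    exact not_negDef_of_subset_of_mem_maximalNullSets hS hTS h
  · intro h
    obtain ⟨S, hS, hST | hST⟩ := exists_minimalNegSet hT h
    · exact negDef_of_mem_minimalNegSets hS hST
    · exact (negDef_of_mem_minimalNegSets hS hST).of_image_sigmaA hT
end

section
/- Let M_A be the 47×47 intersection matrix of Configuration A, with the 45 vertices other than C1, C2 called exceptional vertices, with weights w_j. Consider the linear system over ℚ in variables d_j indexed by the exceptional vertices: for every exceptional vertex j, Σ_i d_i (M_A)_{i,j} = 2 + w_j − (6/7)·a_j, where a_j is the number of edges joining j to {C1, C2} and the sum runs over exceptional vertices i. Then this system has a unique solution d, and: d_j = 0 if and only if j ∈ {e1,…,e15}; 0 < d_j < 6/7 for every weight −2, −3, −4, −7 vertex j; and for every edge {i,j} of Configuration A one has d̂_i + d̂_j < 1, where d̂ extends d by the value 6/7 on C1 and C2. (This expresses that e1,…,e15 are exactly all exceptional divisors of discrepancy 0 over the pair (P(1,2,3), (6/7)C1 + (6/7)C2) of type (A_2^6).) -/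
open Matrix

/-- The exceptional vertices of the configuration: all vertices other than
`C1` (vertex `0`) and `C2` (vertex `16`). -/
def Exc : Type := {v : Fin 47 // v ≠ 0 ∧ v ≠ 16}

instance : Fintype Exc := by unfold Exc; infer_instance

/-- The number of edges joining an exceptional vertex to `{C1, C2}`. -/
def nearC (E : List (ℕ × ℕ)) (j : Exc) : ℚ :=
  (if Adj E j.1 0 then 1 else 0) + (if Adj E j.1 16 then 1 else 0)

/-- The discrepancy system: for every exceptional vertex `j`,
`Σ_i d_i M_{i,j} = 2 + w_j − (6/7)·a_j`, the sum running over exceptional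
vertices. -/
def DiscSys (E : List (ℕ × ℕ)) (d : Exc → ℚ) : Prop :=
  ∀ j : Exc, ∑ i : Exc, d i * interMatrix E i.1 j.1 =
    2 + weights.getD (j.1 : ℕ) 0 - (6 / 7) * nearC E j

/-- The extension of `d` to all 47 vertices taking the value `6/7` on
`C1` and `C2`. -/
def extend (d : Exc → ℚ) : Fin 47 → ℚ := fun v =>
  if h : v ≠ 0 ∧ v ≠ 16 then d ⟨v, h⟩ else 6 / 7

/-- The discrepancy system says that the extended vector `d̂` satisfies the adjunction relations
`Σ_v d̂_v M_{v,j} = 2 + w_j` at all exceptional vertices `j`. -/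
lemma discSys_iff_sum_extend (E : List (ℕ × ℕ)) (d : Exc → ℚ) :
    DiscSys E d ↔ ∀ j : Exc, ∑ v, extend d v * interMatrix E v j.1 =
      2 + weights.getD (j.1 : ℕ) 0 := by
  refine forall_congr' fun j => ?_
  have hsplit : ∑ v, extend d v * interMatrix E v j.1 =
      ∑ i : Exc, d i * interMatrix E i.1 j.1 + 6 / 7 * nearC E j := by
    rw [← Finset.sum_filter_add_sum_filter_not Finset.univ (fun v : Fin 47 => v ≠ 0 ∧ v ≠ 16)]
    refine congrArg₂ (· + ·) ?_ ?_
    · rw [Finset.sum_subtype (p := fun v : Fin 47 => v ≠ 0 ∧ v ≠ 16) _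
        (fun _ => by rw [Finset.mem_filter_univ])]
      refine Finset.sum_congr rfl fun i _ => ?_
      rw [extend, dif_pos i.2]
    · rw [show Finset.univ.filter (fun v : Fin 47 => ¬(v ≠ 0 ∧ v ≠ 16)) = {0, 16} by decide,
        Finset.sum_pair (by decide)]
      have h0 : (0 : Fin 47) ≠ j.1 := fun h => j.2.1 h.symm
      have h16 : (16 : Fin 47) ≠ j.1 := fun h => j.2.2 h.symm
      have hadj : ∀ c, Adj E c j.1 ↔ Adj E j.1 c := fun c => or_comm
      by_cases h1 : Adj E j.1 0 <;> by_cases h2 : Adj E j.1 16 <;>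
        norm_num [extend, interMatrix, nearC, h0, h16, hadj, h1, h2]
  rw [hsplit]
  constructor <;> intro h <;> linarith

/-- The neighbours of the vertex `j` in the graph with edge list `E`. -/
def nbrs (E : List (ℕ × ℕ)) (j : ℕ) : List ℕ :=
  E.flatMap fun e => (if e.2 = j then [e.1] else []) ++ (if e.1 = j then [e.2] else [])

lemma mem_nbrs (E : List (ℕ × ℕ)) (v j : Fin 47) : (v : ℕ) ∈ nbrs E j ↔ Adj E v j := by
  simp only [nbrs, Adj, List.mem_flatMap, List.mem_append, List.mem_ite_nil_right,
    List.mem_singleton, Prod.exists]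
  constructor
  · rintro ⟨a, b, h, ⟨rfl, rfl⟩ | ⟨rfl, rfl⟩⟩
    exacts [.inl h, .inr h]
  · rintro (h | h)
    exacts [⟨_, _, h, .inl ⟨rfl, rfl⟩⟩, ⟨_, _, h, .inr ⟨rfl, rfl⟩⟩]

/-- A column of the intersection matrix in terms of the neighbours of the corresponding vertex. -/
lemma sum_mul_interMatrix (E : List (ℕ × ℕ)) (x : Fin 47 → ℚ) (j : Fin 47)
    (hnodup : (nbrs E j).Nodup) (hmem : ∀ n ∈ nbrs E j, n < 47 ∧ n ≠ j) :
    ∑ v, x v * interMatrix E v j =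
      weights.getD (j : ℕ) 0 * x j + ((nbrs E j).map fun n => x (Fin.ofNat 47 n)).sum := by
  have hsum : ∑ v : Fin 47, (if (v : ℕ) ∈ nbrs E j then x v else 0) =
      ((nbrs E j).map fun n => x (Fin.ofNat 47 n)).sum := by
    have hsub : (nbrs E j).toFinset ⊆ Finset.range 47 := fun n hn =>
      Finset.mem_range.2 (hmem n (List.mem_toFinset.1 hn)).1
    rw [← List.sum_toFinset _ hnodup, ← Finset.inter_eq_right.2 hsub, ← Finset.sum_ite_mem,
      Finset.sum_range]
    simp
  have hdiag : ∑ v, (if v = j then weights.getD (j : ℕ) 0 * x j else 0) =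
      weights.getD (j : ℕ) 0 * x j := by
    rw [Finset.sum_ite_eq', if_pos (Finset.mem_univ j)]
  rw [← hsum, ← hdiag, ← Finset.sum_add_distrib]
  refine Finset.sum_congr rfl fun v _ => ?_
  by_cases hvj : v = j
  · subst hvj
    have hv : (v : ℕ) ∉ nbrs E v := fun h => (hmem v h).2 rfl
    simp [interMatrix, hv, mul_comm]
  · simp [interMatrix, hvj, mem_nbrs]

lemma nbrs_edgesA (j : Fin 47) :
    (nbrs edgesA j).Nodup ∧ ∀ n ∈ nbrs edgesA j, n < 47 ∧ n ≠ j := by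
  revert j
  decide +kernel

/-- The discrepancy system of Configuration A as a relation between neighbours. -/
lemma discSys_edgesA_iff (d : Exc → ℚ) :
    DiscSys edgesA d ↔ ∀ j : Fin 47, j ≠ 0 ∧ j ≠ 16 → weights.getD (j : ℕ) 0 * extend d j +
      ((nbrs edgesA j).map fun n => extend d (Fin.ofNat 47 n)).sum =
        2 + weights.getD (j : ℕ) 0 := by
  rw [discSys_iff_sum_extend]
  constructor
  · intro h j hj
    rw [← sum_mul_interMatrix _ _ _ (nbrs_edgesA j).1 (nbrs_edgesA j).2]
    exact h ⟨j, hj⟩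
  · intro h j
    rw [sum_mul_interMatrix _ _ _ (nbrs_edgesA j.1).1 (nbrs_edgesA j.1).2]
    exact h j.1 j.2

/-- The relation at a vertex `j` with exactly one neighbour. -/
lemma DiscSys.eq_of_one {d : Exc → ℚ} (hd : DiscSys edgesA d) (j a : Fin 47) (w : ℚ)
    (hj : j ≠ 0 ∧ j ≠ 16) (hs : nbrs edgesA j = [↑a]) (hw : weights.getD (j : ℕ) 0 = w) :
    w * extend d j + extend d a = 2 + w := by
  have h := (discSys_edgesA_iff d).1 hd j hj
  rw [hw, hs] at h
  simpa using h

/-- The relation at a vertex `j` with exactly two neighbours. -/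
lemma DiscSys.eq_of_two {d : Exc → ℚ} (hd : DiscSys edgesA d) (j a b : Fin 47) (w : ℚ)
    (hj : j ≠ 0 ∧ j ≠ 16) (hs : nbrs edgesA j = [↑a, ↑b]) (hw : weights.getD (j : ℕ) 0 = w) :
    w * extend d j + (extend d a + extend d b) = 2 + w := by
  have h := (discSys_edgesA_iff d).1 hd j hj
  rw [hw, hs] at h
  simpa using h

/-- The extended solution of the discrepancy system of Configuration A. -/
def solA : Fin 47 → ℚ := fun v =>
  ([6, 0, 0, 0, 0, 0, 0, 0, 0, 0, 0, 0, 0, 0, 0, 0, 6, 3, 2, 1, 1, 2, 3, 4,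
    2, 1, 2, 3, 4, 2, 5, 2, 4, 3, 2, 1, 1, 2, 3, 4, 2, 5, 2, 4, 3, 2, 1] :
    List ℚ).getD (v : ℕ) 0 / 7

lemma extend_solA : extend (fun j => solA j.1) = solA := by
  funext v
  by_cases h : v ≠ 0 ∧ v ≠ 16
  · rw [extend, dif_pos h]
  · rw [extend, dif_neg h]
    revert v
    decide +kernel

lemma discSys_solA : DiscSys edgesA fun j => solA j.1 := by
  rw [discSys_edgesA_iff, extend_solA]
  decide +kernel

/-- The discrepancy system determines `d̂` on the first chain. -/
lemma DiscSys.eq_solA_first_chain {d : Exc → ℚ} (hd : DiscSys edgesA d) :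
    ∀ v ∈ ([17, 18, 19, 1] : List (Fin 47)),
      extend d v = solA v := by
  have h0 : extend d 0 = 6 / 7 := rfl
  have h18 : extend d 18 = 3 * extend d 17 - 1 := by
    linarith only [hd.eq_of_one 17 18 (-3) (by decide) (by decide +kernel) rfl]
  have h19 : extend d 19 = 5 * extend d 17 - 2 := by
    linarith only [hd.eq_of_two 18 17 19 (-2) (by decide) (by decide +kernel) rfl, h18]
  have h1 : extend d 1 = 7 * extend d 17 - 3 := by
    linarith only [hd.eq_of_two 19 18 1 (-2) (by decide) (by decide +kernel) rfl, h18, h19]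
  have h17 : extend d 17 = 3 / 7 := by
    linarith only [hd.eq_of_two 1 19 0 (-1) (by decide) (by decide +kernel) rfl, h19, h0, h1]
  simp only [List.forall_mem_cons, List.not_mem_nil, false_imp_iff, implies_true, and_true,
    h17, h18, h19, h1]
  norm_num [solA]

/-- The discrepancy system determines `d̂` on the second chain. -/
lemma DiscSys.eq_solA_second_chain {d : Exc → ℚ} (hd : DiscSys edgesA d) :
    ∀ v ∈ ([2, 20, 21, 22, 3, 23, 24] : List (Fin 47)),
      extend d v = solA v := by
  have h0 : extend d 0 = 6 / 7 := rfl
  have h20 : extend d 20 = extend d 2 + 1 / 7 := by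
    linarith only [hd.eq_of_two 2 0 20 (-1) (by decide) (by decide +kernel) rfl, h0]
  have h21 : extend d 21 = extend d 2 + 2 / 7 := by
    linarith only [hd.eq_of_two 20 2 21 (-2) (by decide) (by decide +kernel) rfl, h20]
  have h22 : extend d 22 = extend d 2 + 3 / 7 := by
    linarith only [hd.eq_of_two 21 20 22 (-2) (by decide) (by decide +kernel) rfl, h20, h21]
  have h3 : extend d 3 = 2 * extend d 2 := by
    linarith only [hd.eq_of_two 22 21 3 (-3) (by decide) (by decide +kernel) rfl, h21, h22]
  have h23 : extend d 23 = extend d 2 + 4 / 7 := by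
    linarith only [hd.eq_of_two 3 22 23 (-1) (by decide) (by decide +kernel) rfl, h22, h3]
  have h24 : extend d 24 = 2 * extend d 2 + 2 / 7 := by
    linarith only [hd.eq_of_two 23 3 24 (-4) (by decide) (by decide +kernel) rfl, h3, h23]
  have h2 : extend d 2 = 0 := by
    linarith only [hd.eq_of_one 24 23 (-2) (by decide) (by decide +kernel) rfl, h23, h24]
  simp only [List.forall_mem_cons, List.not_mem_nil, false_imp_iff, implies_true, and_true,
    h2, h20, h21, h22, h3, h23, h24]
  norm_num [solA]

/-- The discrepancy system determines `d̂` on the third chain. -/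
lemma DiscSys.eq_solA_third_chain {d : Exc → ℚ} (hd : DiscSys edgesA d) :
    ∀ v ∈ ([4, 25, 26, 27, 5, 28, 29, 6, 30, 7, 31, 32, 8, 33, 34, 35, 9] : List (Fin 47)),
      extend d v = solA v := by
  have h0 : extend d 0 = 6 / 7 := rfl
  have h16 : extend d 16 = 6 / 7 := rfl
  have h25 : extend d 25 = extend d 4 + 1 / 7 := by
    linarith only [hd.eq_of_two 4 0 25 (-1) (by decide) (by decide +kernel) rfl, h0]
  have h26 : extend d 26 = extend d 4 + 2 / 7 := by
    linarith only [hd.eq_of_two 25 4 26 (-2) (by decide) (by decide +kernel) rfl, h25]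
  have h27 : extend d 27 = extend d 4 + 3 / 7 := by
    linarith only [hd.eq_of_two 26 25 27 (-2) (by decide) (by decide +kernel) rfl, h25, h26]
  have h5 : extend d 5 = 2 * extend d 4 := by
    linarith only [hd.eq_of_two 27 26 5 (-3) (by decide) (by decide +kernel) rfl, h26, h27]
  have h28 : extend d 28 = extend d 4 + 4 / 7 := by
    linarith only [hd.eq_of_two 5 27 28 (-1) (by decide) (by decide +kernel) rfl, h27, h5]
  have h29 : extend d 29 = 2 * extend d 4 + 2 / 7 := by
    linarith only [hd.eq_of_two 28 5 29 (-4) (by decide) (by decide +kernel) rfl, h5, h28]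
  have h6 : extend d 6 = 3 * extend d 4 := by
    linarith only [hd.eq_of_two 29 28 6 (-2) (by decide) (by decide +kernel) rfl, h28, h29]
  have h30 : extend d 30 = extend d 4 + 5 / 7 := by
    linarith only [hd.eq_of_two 6 29 30 (-1) (by decide) (by decide +kernel) rfl, h29, h6]
  have h7 : extend d 7 = 4 * extend d 4 := by
    linarith only [hd.eq_of_two 30 6 7 (-7) (by decide) (by decide +kernel) rfl, h6, h30]
  have h31 : extend d 31 = 3 * extend d 4 + 2 / 7 := by
    linarith only [hd.eq_of_two 7 30 31 (-1) (by decide) (by decide +kernel) rfl, h30, h7]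
  have h32 : extend d 32 = 2 * extend d 4 + 4 / 7 := by
    linarith only [hd.eq_of_two 31 7 32 (-2) (by decide) (by decide +kernel) rfl, h7, h31]
  have h8 : extend d 8 = 5 * extend d 4 := by
    linarith only [hd.eq_of_two 32 31 8 (-4) (by decide) (by decide +kernel) rfl, h31, h32]
  have h33 : extend d 33 = 3 * extend d 4 + 3 / 7 := by
    linarith only [hd.eq_of_two 8 32 33 (-1) (by decide) (by decide +kernel) rfl, h32, h8]
  have h34 : extend d 34 = 4 * extend d 4 + 2 / 7 := by
    linarith only [hd.eq_of_two 33 8 34 (-3) (by decide) (by decide +kernel) rfl, h8, h33]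
  have h35 : extend d 35 = 5 * extend d 4 + 1 / 7 := by
    linarith only [hd.eq_of_two 34 33 35 (-2) (by decide) (by decide +kernel) rfl, h33, h34]
  have h9 : extend d 9 = 6 * extend d 4 := by
    linarith only [hd.eq_of_two 35 34 9 (-2) (by decide) (by decide +kernel) rfl, h34, h35]
  have h4 : extend d 4 = 0 := by
    linarith only [hd.eq_of_two 9 35 16 (-1) (by decide) (by decide +kernel) rfl, h35, h16, h9]
  simp only [List.forall_mem_cons, List.not_mem_nil, false_imp_iff, implies_true, and_true,
    h4, h25, h26, h27, h5, h28, h29, h6, h30, h7, h31, h32,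
    h8, h33, h34, h35, h9]
  norm_num [solA]

/-- The discrepancy system determines `d̂` on the fourth chain. -/
lemma DiscSys.eq_solA_fourth_chain {d : Exc → ℚ} (hd : DiscSys edgesA d) :
    ∀ v ∈ ([10, 36, 37, 38, 11, 39, 40, 12, 41, 13, 42, 43, 14, 44, 45, 46, 15] : List (Fin 47)),
      extend d v = solA v := by
  have h16 : extend d 16 = 6 / 7 := rfl
  have h36 : extend d 36 = extend d 10 + 1 / 7 := by
    linarith only [hd.eq_of_two 10 16 36 (-1) (by decide) (by decide +kernel) rfl, h16]
  have h37 : extend d 37 = extend d 10 + 2 / 7 := by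
    linarith only [hd.eq_of_two 36 10 37 (-2) (by decide) (by decide +kernel) rfl, h36]
  have h38 : extend d 38 = extend d 10 + 3 / 7 := by
    linarith only [hd.eq_of_two 37 36 38 (-2) (by decide) (by decide +kernel) rfl, h36, h37]
  have h11 : extend d 11 = 2 * extend d 10 := by
    linarith only [hd.eq_of_two 38 37 11 (-3) (by decide) (by decide +kernel) rfl, h37, h38]
  have h39 : extend d 39 = extend d 10 + 4 / 7 := by
    linarith only [hd.eq_of_two 11 38 39 (-1) (by decide) (by decide +kernel) rfl, h38, h11]
  have h40 : extend d 40 = 2 * extend d 10 + 2 / 7 := by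
    linarith only [hd.eq_of_two 39 11 40 (-4) (by decide) (by decide +kernel) rfl, h11, h39]
  have h12 : extend d 12 = 3 * extend d 10 := by
    linarith only [hd.eq_of_two 40 39 12 (-2) (by decide) (by decide +kernel) rfl, h39, h40]
  have h41 : extend d 41 = extend d 10 + 5 / 7 := by
    linarith only [hd.eq_of_two 12 40 41 (-1) (by decide) (by decide +kernel) rfl, h40, h12]
  have h13 : extend d 13 = 4 * extend d 10 := by
    linarith only [hd.eq_of_two 41 12 13 (-7) (by decide) (by decide +kernel) rfl, h12, h41]
  have h42 : extend d 42 = 3 * extend d 10 + 2 / 7 := by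
    linarith only [hd.eq_of_two 13 41 42 (-1) (by decide) (by decide +kernel) rfl, h41, h13]
  have h43 : extend d 43 = 2 * extend d 10 + 4 / 7 := by
    linarith only [hd.eq_of_two 42 13 43 (-2) (by decide) (by decide +kernel) rfl, h13, h42]
  have h14 : extend d 14 = 5 * extend d 10 := by
    linarith only [hd.eq_of_two 43 42 14 (-4) (by decide) (by decide +kernel) rfl, h42, h43]
  have h44 : extend d 44 = 3 * extend d 10 + 3 / 7 := by
    linarith only [hd.eq_of_two 14 43 44 (-1) (by decide) (by decide +kernel) rfl, h43, h14]
  have h45 : extend d 45 = 4 * extend d 10 + 2 / 7 := by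
    linarith only [hd.eq_of_two 44 14 45 (-3) (by decide) (by decide +kernel) rfl, h14, h44]
  have h46 : extend d 46 = 5 * extend d 10 + 1 / 7 := by
    linarith only [hd.eq_of_two 45 44 46 (-2) (by decide) (by decide +kernel) rfl, h44, h45]
  have h15 : extend d 15 = 6 * extend d 10 := by
    linarith only [hd.eq_of_two 46 45 15 (-2) (by decide) (by decide +kernel) rfl, h45, h46]
  have h10 : extend d 10 = 0 := by
    linarith only [hd.eq_of_two 15 46 16 (-1) (by decide) (by decide +kernel) rfl, h46, h16, h15]
  simp only [List.forall_mem_cons, List.not_mem_nil, false_imp_iff, implies_true, and_true,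
    h10, h36, h37, h38, h11, h39, h40, h12, h41, h13, h42, h43,
    h14, h44, h45, h46, h15]
  norm_num [solA]

lemma DiscSys.extend_eq_solA {d : Exc → ℚ} (hd : DiscSys edgesA d) : extend d = solA := by
  funext v
  have hv : v ∈ ([0, 16] : List (Fin 47)) ∨
      v ∈ ([17, 18, 19, 1] : List (Fin 47)) ∨
      v ∈ ([2, 20, 21, 22, 3, 23, 24] : List (Fin 47)) ∨
      v ∈ ([4, 25, 26, 27, 5, 28, 29, 6, 30, 7, 31, 32, 8, 33, 34, 35, 9] : List (Fin 47)) ∨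
      v ∈ ([10, 36, 37, 38, 11, 39, 40, 12, 41, 13, 42, 43, 14, 44, 45, 46, 15] : List (Fin 47)) := by
    revert v
    decide +kernel
  rcases hv with hv | hv | hv | hv | hv
  · have hC : ∀ c ∈ ([0, 16] : List (Fin 47)), ¬(c ≠ 0 ∧ c ≠ 16) ∧ (6 / 7 : ℚ) = solA c := by
      decide +kernel
    rw [extend, dif_neg (hC v hv).1, (hC v hv).2]
  · exact hd.eq_solA_first_chain v hv
  · exact hd.eq_solA_second_chain v hv
  · exact hd.eq_solA_third_chain v hv
  · exact hd.eq_solA_fourth_chain v hv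

lemma DiscSys.apply_eq_solA {d : Exc → ℚ} (hd : DiscSys edgesA d) (j : Exc) :
    d j = solA j.1 := by
  rw [← hd.extend_eq_solA, extend, dif_pos j.2]
  rfl

/-- In Configuration A, the discrepancy system has a unique solution `d`, the
vertices `e_1, …, e_15` are exactly those with `d_j = 0`, every weight
`-2,-3,-4,-7` vertex satisfies `0 < d_j < 6/7`, and along every edge the
extended values satisfy `d̂_i + d̂_j < 1`: that is, `e_1, …, e_15` are exactly
all the exceptional divisors of discrepancy `0` over the pair
`(ℙ(1,2,3), (6/7)C1 + (6/7)C2)` of type (A₂⁶). -/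
theorem discrepancy_zero_divisors_A26 :
    (∃! d : Exc → ℚ, DiscSys edgesA d) ∧
      ∀ d : Exc → ℚ, DiscSys edgesA d →
        (∀ j : Exc, d j = 0 ↔ (j.1 : ℕ) ∈ Finset.Icc 1 15) ∧
        (∀ j : Exc, 17 ≤ (j.1 : ℕ) → 0 < d j ∧ d j < 6 / 7) ∧
        (∀ i j : Fin 47, Adj edgesA i j → extend d i + extend d j < 1) := by
  refine ⟨⟨_, discSys_solA, fun d hd => funext hd.apply_eq_solA⟩, fun d hd => ⟨?_, ?_, ?_⟩⟩
  · intro j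
    rw [hd.apply_eq_solA]
    have h : ∀ v : Fin 47, solA v = 0 ↔ (v : ℕ) ∈ Finset.Icc 1 15 := by decide +kernel
    exact h j.1
  · intro j hj
    rw [hd.apply_eq_solA]
    have h : ∀ v : Fin 47, 17 ≤ (v : ℕ) → 0 < solA v ∧ solA v < 6 / 7 := by decide +kernel
    exact h j.1 hj
  · intro u v huv
    rw [hd.extend_eq_solA]
    have h : ∀ e ∈ edgesA, solA (Fin.ofNat 47 e.1) + solA (Fin.ofNat 47 e.2) < 1 := by
      decide +kernel
    rcases huv with huv | huv
    · simpa using h _ huv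
    · simpa [add_comm] using h _ huv
end

section
/- Let M_B be the 47×47 intersection matrix of Configuration B, with the 45 vertices other than C1, C2 called exceptional vertices, with weights w_j. Consider the linear system over ℚ in variables d_j indexed by the exceptional vertices: for every exceptional vertex j, Σ_i d_i (M_B)_{i,j} = 2 + w_j − (6/7)·a_j, where a_j is the number of edges joining j to {C1, C2} and the sum runs over exceptional vertices i. Then this system has a unique solution d, and: d_j = 0 if and only if j ∈ {e1,…,e15}; 0 < d_j < 6/7 for every weight −2, −3, −4, −7 vertex j; and for every edge {i,j} of Configuration B one has d̂_i + d̂_j < 1, where d̂ extends d by the value 6/7 on C1 and C2. (This expresses that e1,…,e15 are exactly all exceptional divisors of discrepancy 0 over the pair (P(1,2,3), (6/7)C1 + (6/7)C2) of type (I_2^2).) -/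
open Matrix

/-- A matrix over an ordered field with nonnegative off-diagonal entries and a positive vector `u`
with `u A < 0` entrywise has trivial left kernel. -/
theorem eq_zero_of_sum_mul_eq_zero {ι K : Type*} [Fintype ι] [Field K] [LinearOrder K]
    [IsStrictOrderedRing K] (A : ι → ι → K) (u x : ι → K)
    (hA : ∀ i j, i ≠ j → 0 ≤ A i j) (hu : ∀ i, 0 < u i)
    (huA : ∀ j, ∑ i, u i * A i j < 0) (hx : ∀ j, ∑ i, x i * A i j = 0) : x = 0 := by
  have nonpos : ∀ y : ι → K, (∀ j, ∑ i, y i * A i j = 0) → ∀ i, y i ≤ 0 := by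
    intro y hy i
    by_contra! hi
    obtain ⟨k, -, hk⟩ :=
      Finset.exists_max_image Finset.univ (fun i => y i / u i) ⟨i, Finset.mem_univ i⟩
    have hpos : 0 < y k / u k := (div_pos hi (hu i)).trans_le (hk i (Finset.mem_univ i))
    have hle : ∑ i, y i * A i k ≤ ∑ i, y k / u k * (u i * A i k) := by
      refine Finset.sum_le_sum fun j _ => ?_
      rcases eq_or_ne j k with rfl | hjk
      · rw [← mul_assoc, div_mul_cancel₀ _ (hu j).ne']
      · rw [← mul_assoc]
        exact mul_le_mul_of_nonneg_right
          ((div_le_iff₀ (hu j)).mp (hk j (Finset.mem_univ j))) (hA j k hjk)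
    rw [hy k, ← Finset.mul_sum] at hle
    exact (mul_neg_of_pos_of_neg hpos (huA k)).not_ge hle
  funext i
  refine le_antisymm (nonpos x hx i) ?_
  have := nonpos (-x) (fun j => by simp [hx j]) i
  simpa using this

/-- The list of neighbours of `j` in the graph with edge list `E`. -/
def neighbours (E : List (ℕ × ℕ)) (j : ℕ) : List ℕ :=
  E.flatMap fun p => if p.1 = j then [p.2] else if p.2 = j then [p.1] else []

theorem mem_neighbours_of_adj {E : List (ℕ × ℕ)} (hE : ∀ p ∈ E, p.1 ≠ p.2) {i j : Fin 47}
    (h : Adj E i j) : (i : ℕ) ∈ neighbours E j := by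
  rw [neighbours, List.mem_flatMap]
  rcases h with h | h
  · exact ⟨_, h, by simp [hE _ h]⟩
  · exact ⟨_, h, by simp⟩

theorem adj_of_mem_neighbours {E : List (ℕ × ℕ)} {i j : Fin 47}
    (h : (i : ℕ) ∈ neighbours E j) : Adj E i j := by
  rw [neighbours, List.mem_flatMap] at h
  obtain ⟨⟨a, b⟩, hp, h⟩ := h
  dsimp only at h
  split_ifs at h with h1 h2
  · rw [List.mem_singleton] at h
    exact Or.inr (h ▸ h1 ▸ hp)
  · rw [List.mem_singleton] at h
    exact Or.inl (h ▸ h2 ▸ hp)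
  · simp at h

theorem sum_mul_interMatrix_s10 {E : List (ℕ × ℕ)} (hE : ∀ p ∈ E, p.1 ≠ p.2 ∧ p.1 < 47 ∧ p.2 < 47)
    (x : ℕ → ℚ) (j : Fin 47) (hj : (neighbours E j).Nodup) :
    ∑ i : Fin 47, x i * interMatrix E i j =
      x j * weights.getD (j : ℕ) 0 + ((neighbours E j).map x).sum := by
  have hlt : ∀ i ∈ neighbours E j, i < 47 ∧ i ≠ j := by
    intro i hi
    rw [neighbours, List.mem_flatMap] at hi
    obtain ⟨⟨a, b⟩, hp, hi⟩ := hi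
    have := hE _ hp
    dsimp only at hi this
    split_ifs at hi <;> simp at hi <;> omega
  have key : ∀ i : Fin 47, x i * interMatrix E i j =
      (if i = j then x j * weights.getD (j : ℕ) 0 else 0) +
        if (i : ℕ) ∈ neighbours E j then x i else 0 := by
    intro i
    have hadj : Adj E i j ↔ (i : ℕ) ∈ neighbours E j :=
      ⟨mem_neighbours_of_adj fun p hp => (hE p hp).1, adj_of_mem_neighbours⟩
    rcases eq_or_ne i j with rfl | hij
    · have : (i : ℕ) ∉ neighbours E i := fun h => (hlt _ h).2 rfl
      simp [interMatrix, this]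
    · simp [interMatrix, hij, hadj]
  rw [Finset.sum_congr rfl fun i _ => key i, Finset.sum_add_distrib,
    Finset.sum_ite_eq' Finset.univ j, if_pos (Finset.mem_univ j),
    Fin.sum_univ_eq_sum_range (fun i => if i ∈ neighbours E j then x i else 0) 47,
    ← Finset.sum_filter, ← List.sum_toFinset x hj]
  congr 1
  refine Finset.sum_congr ?_ fun _ _ => rfl
  ext i
  simpa using fun h => (hlt i h).1

theorem sum_exc_mul_interMatrix_edgesB (x : ℕ → ℚ) (h0 : x 0 = 0) (h16 : x 16 = 0) (j : Exc) :
    ∑ i : Exc, x i.1 * interMatrix edgesB i.1 j.1 =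
      x j.1 * weights.getD (j.1 : ℕ) 0 + ((neighbours edgesB j.1).map x).sum := by
  have hnodup : ∀ j : Fin 47, (neighbours edgesB j).Nodup := by decide +kernel
  rw [← sum_mul_interMatrix_s10 (by decide +kernel) x j.1 (hnodup j.1)]
  refine (Finset.sum_subtype {v : Fin 47 | v ≠ 0 ∧ v ≠ 16} (by simp)
    fun i => x i * interMatrix edgesB i j.1).symm.trans
      (Finset.sum_subset (Finset.subset_univ _) fun i _ hi => ?_)
  obtain rfl | rfl : i = 0 ∨ i = 16 := by simpa [or_iff_not_imp_left] using hi
  · simp [h0]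
  · simp [h16]

/-- The numerators over `7` of the solution of the discrepancy system of Configuration B. -/
def discNumerators : List ℚ :=
  [0, 0,0,0,0,0,0,0,0,0,0,0,0,0,0,0, 0,
   3,2,1,
   1,2,3,4,2,
   1,2,3,4,2,5,2,4,3,2,1,
   1,2,3,4,2,5,2,4,3,2,1]

/-- The solution of the discrepancy system of Configuration B. -/
def discSol (j : Exc) : ℚ := discNumerators.getD (j.1 : ℕ) 0 / 7

/-- The solution of the discrepancy system of Configuration B, extended by `6/7` to `C1`
and `C2`, as a function of the vertex number. -/
def extendedDisc (n : ℕ) : ℚ :=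
  if n = 0 ∨ n = 16 then 6 / 7 else discNumerators.getD n 0 / 7

/-- A positive vector whose product with the intersection matrix of the exceptional
vertices of Configuration B has all entries equal to `-1`. -/
def superharmonic : List ℚ :=
  [0, 8,16,16,45,74,87,87,74,45,45,74,87,87,74,45, 0,
   2,5,7,
   15,13,10,5,3,
   44,42,39,34,61,25,61,34,39,42,44,
   44,42,39,34,61,25,61,34,39,42,44]

theorem discSys_discSol : DiscSys edgesB discSol := by
  intro j
  refine (sum_exc_mul_interMatrix_edgesB (fun i => discNumerators.getD i 0 / 7)
    (by decide +kernel) (by decide +kernel) j).trans ?_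
  revert j
  decide +kernel

theorem discSys_edgesB_unique {d d' : Exc → ℚ} (hd : DiscSys edgesB d)
    (hd' : DiscSys edgesB d') : d = d' := by
  refine sub_eq_zero.mp (eq_zero_of_sum_mul_eq_zero (fun i j : Exc => interMatrix edgesB i.1 j.1)
    (fun i => superharmonic.getD (i.1 : ℕ) 0) _ (fun i j hij => ?_) ?_ ?_ fun j => ?_)
  · have : i.1 ≠ j.1 := fun h => hij (Subtype.ext h)
    simp only [interMatrix, Matrix.of_apply, if_neg this]
    split_ifs <;> norm_num
  · decide +kernel
  · intro j
    rw [sum_exc_mul_interMatrix_edgesB (fun i => superharmonic.getD i 0) rfl rfl j]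
    revert j
    decide +kernel
  · simp only [Pi.sub_apply, sub_mul, Finset.sum_sub_distrib]
    rw [hd j, hd' j, sub_self]

/-- In Configuration B, the discrepancy system has a unique solution `d`, the
vertices `e_1, …, e_15` are exactly those with `d_j = 0`, every weight
`-2,-3,-4,-7` vertex satisfies `0 < d_j < 6/7`, and along every edge the
extended values satisfy `d̂_i + d̂_j < 1`: that is, `e_1, …, e_15` are exactly
all the exceptional divisors of discrepancy `0` over the pair
`(ℙ(1,2,3), (6/7)C1 + (6/7)C2)` of type (I₂²). -/
theorem discrepancy_zero_divisors_I22 :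
    (∃! d : Exc → ℚ, DiscSys edgesB d) ∧
      ∀ d : Exc → ℚ, DiscSys edgesB d →
        (∀ j : Exc, d j = 0 ↔ (j.1 : ℕ) ∈ Finset.Icc 1 15) ∧
        (∀ j : Exc, 17 ≤ (j.1 : ℕ) → 0 < d j ∧ d j < 6 / 7) ∧
        (∀ i j : Fin 47, Adj edgesB i j → extend d i + extend d j < 1) := by
  refine ⟨⟨discSol, discSys_discSol, fun d hd => discSys_edgesB_unique hd discSys_discSol⟩, ?_⟩
  intro d hd
  obtain rfl := discSys_edgesB_unique hd discSys_discSol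
  have hext : ∀ v : Fin 47, extend discSol v = extendedDisc v := by decide +kernel
  have hedge : ∀ p ∈ edgesB, extendedDisc p.1 + extendedDisc p.2 < 1 := by decide +kernel
  refine ⟨by decide +kernel, by decide +kernel, fun i j h => ?_⟩
  rw [hext i, hext j]
  rcases h with h | h
  · exact hedge (i, j) h
  · rw [add_comm]
    exact hedge (j, i) h
end

section
/- Let M_A and M_B be the intersection matrices of Configurations A and B respectively, and for T ⊆ {1,…,15} let M_A(T) (resp. M_B(T)) be the principal submatrix obtained by deleting the rows and columns of the vertices e_j with j ∈ T. If M_A(T) is negative definite then |T| ≥ 2, and likewise if M_B(T) is negative definite then |T| ≥ 2. (Since the Picard number of the resulting log Enriques surface S equals |T| − 1, and |T| ≤ 15, this yields 1 ≤ ρ(S) ≤ 14 for every log Enriques surface S with δ = 2.) -/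
open Matrix

/-- A nonzero vector supported away from `T` on which the form of `M` is nonnegative
obstructs the negative definiteness of the principal submatrix `delSub M T`. -/
theorem not_negDef_delSub {M : Matrix (Fin 47) (Fin 47) ℚ} {T : Finset ℕ} {x : Fin 47 → ℚ}
    (hx : x ≠ 0) (hT : ∀ v : Fin 47, (v : ℕ) ∈ T → x v = 0) (hM : 0 ≤ x ⬝ᵥ M *ᵥ x) :
    ¬ NegDef (delSub M T) := by
  have sum_eq (g : Fin 47 → ℚ) (hg : ∀ v : Fin 47, (v : ℕ) ∈ T → g v = 0) :
      ∑ v : {v : Fin 47 // (v : ℕ) ∉ T}, g v = ∑ v, g v :=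
    Fintype.sum_of_injective Subtype.val Subtype.val_injective _ _
      (fun v hv => hg v (by simpa using hv)) fun _ => rfl
  intro h
  have hne : (fun v : {v : Fin 47 // (v : ℕ) ∉ T} => x v) ≠ 0 := fun h0 => hx <| funext fun v => by
    by_cases hv : (v : ℕ) ∈ T
    · exact hT v hv
    · exact congrFun h0 ⟨v, hv⟩
  refine (h _ hne).not_ge (hM.trans_eq ?_)
  simp only [dotProduct, mulVec, delSub, submatrix_apply]
  rw [← sum_eq _ fun v hv => by rw [hT v hv, zero_mul]]
  refine Finset.sum_congr rfl fun v _ => ?_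
  rw [← sum_eq _ fun w hw => by rw [hT w hw, mul_zero]]

/-- If the form of `M` is nonnegative on two nonzero vectors with disjoint supports, then at
least two vertices have to be deleted to make it negative definite. -/
theorem two_le_card_of_negDef_delSub {M : Matrix (Fin 47) (Fin 47) ℚ} {T : Finset ℕ}
    {x y : Fin 47 → ℚ} (hx : x ≠ 0) (hy : y ≠ 0) (hxy : ∀ v, x v = 0 ∨ y v = 0)
    (hMx : 0 ≤ x ⬝ᵥ M *ᵥ x) (hMy : 0 ≤ y ⬝ᵥ M *ᵥ y) (h : NegDef (delSub M T)) :
    2 ≤ T.card := by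
  have meets {z : Fin 47 → ℚ} (hz : z ≠ 0) (hMz : 0 ≤ z ⬝ᵥ M *ᵥ z) :
      ∃ v : Fin 47, (v : ℕ) ∈ T ∧ z v ≠ 0 := by
    by_contra! hT
    exact not_negDef_delSub hz hT hMz h
  obtain ⟨a, haT, ha⟩ := meets hx hMx
  obtain ⟨b, hbT, hb⟩ := meets hy hMy
  refine Finset.one_lt_card.2 ⟨a, haT, b, hbT, fun hab => ?_⟩
  obtain rfl := Fin.ext hab
  exact (hxy a).elim ha hb

/-- An isotropic vector of Configuration A, supported on `C1` and chains (i)–(iii). -/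
def isotropicA₁ : Fin 47 → ℚ :=
  ![2, 7, 9, 4, 12, 10, 8, 6, 4, 2, 0, 0, 0, 0, 0, 0, 0,
    1, 3, 5, 7, 5, 3, 1, 1, 10, 8, 6, 4, 6, 2, 4, 2, 2, 2, 2,
    0, 0, 0, 0, 0, 0, 0, 0, 0, 0, 0]

/-- An isotropic vector of Configuration A, supported on the cycle formed by `C2` and chain (iv). -/
def isotropicA₂ : Fin 47 → ℚ :=
  ![0, 0, 0, 0, 0, 0, 0, 0, 0, 0, 7, 7, 7, 7, 7, 7, 1,
    0, 0, 0, 0, 0, 0, 0, 0, 0, 0, 0, 0, 0, 0, 0, 0, 0, 0, 0,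
    6, 5, 4, 3, 5, 2, 5, 3, 4, 5, 6]

/-- An isotropic vector of Configuration B, supported on a subtree containing `C1`. -/
def isotropicB₁ : Fin 47 → ℚ :=
  ![4, 14, 0, 0, 21, 14, 7, 0, 0, 0, 21, 14, 7, 0, 0, 0, 0,
    2, 6, 10, 0, 0, 0, 0, 0, 17, 13, 9, 5, 6, 1, 0, 0, 0, 0, 0,
    17, 13, 9, 5, 6, 1, 0, 0, 0, 0, 0]

/-- An isotropic vector of Configuration B, supported on a subtree containing `C2`. -/
def isotropicB₂ : Fin 47 → ℚ :=
  ![0, 0, 9, 4, 0, 0, 0, 0, 4, 9, 0, 0, 0, 2, 6, 10, 2,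
    0, 0, 0, 7, 5, 3, 1, 1, 0, 0, 0, 0, 0, 0, 1, 1, 3, 5, 7,
    0, 0, 0, 0, 0, 0, 2, 2, 4, 6, 8]

/-- **Bounds on the Picard number.**  If the principal submatrix `M_A(T)`
(resp. `M_B(T)`) of the intersection matrix of Configuration A (resp. B)
obtained by deleting the vertices `e_j`, `j ∈ T`, is negative definite, then
`|T| ≥ 2`.  Since the Picard number of the resulting log Enriques surface `S`
is `|T| − 1` and `|T| ≤ 15`, this yields `1 ≤ ρ(S) ≤ 14` for every
log Enriques surface `S` with `δ = 2`. -/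
theorem picard_number_bound (T : Finset ℕ) (hT : T ⊆ Finset.Icc 1 15) :
    (NegDef (delSub MA T) → 2 ≤ T.card) ∧
      (NegDef (delSub MB T) → 2 ≤ T.card) := by
  refine ⟨two_le_card_of_negDef_delSub (x := isotropicA₁) (y := isotropicA₂) ?_ ?_ ?_ ?_ ?_,
    two_le_card_of_negDef_delSub (x := isotropicB₁) (y := isotropicB₂) ?_ ?_ ?_ ?_ ?_⟩ <;>
  decide +kernel
end
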